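/- Let R be a commutative ring and S a commutative R-algebra with a finite group G acting on S by R-algebra automorphisms, and assume the fixed subring S^G equals the image of R in S. Then S/R is a G-Galois extension if and only if there exist a natural number n and elements u_1,…,u_n, v_1,…,v_n ∈ S such that for every γ ∈ G, ∑_{i=1}^n u_i·(γ•v_i) equals 1 if γ = 1 and equals 0 otherwise. -/

import Mathlib

open scoped TensorProduct

/-- The map `Θ : S ⊗[R] S → ∏_{γ ∈ G} S`, `Θ(u ⊗ v) = (u · (γ • v))_{γ ∈ G}`,
where `G` acts on `S` via a homomorphism `ρ : G →* (S ≃ₐ[R] S)`. -/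
noncomputable def thetaMap (R S G : Type) [CommRing R] [CommRing S] [Algebra R S]
    [Group G] (ρ : G →* (S ≃ₐ[R] S)) : S ⊗[R] S →ₗ[R] (G → S) :=
  TensorProduct.lift
    (LinearMap.mk₂ R (fun u v γ => u * ρ γ v)
      (fun u u' v => by funext γ; simp [add_mul])
      (fun c u v => by funext γ; simp [smul_mul_assoc])
      (fun u v v' => by funext γ; simp [mul_add])
      (fun c u v => by funext γ; simp [mul_smul_comm]))

/-- `S/R` is a `G`-Galois extension: the fixed subring `S^G` equals the image of `R`
and `Θ` is bijective. -/
def IsBNGaloisExtension (R S G : Type) [CommRing R] [CommRing S] [Algebra R S]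
    [Group G] (ρ : G →* (S ≃ₐ[R] S)) : Prop :=
  ({s : S | ∀ γ : G, ρ γ s = s} = Set.range (algebraMap R S)) ∧
  Function.Bijective (thetaMap R S G ρ)

section Helpers

variable {R S G : Type} [CommRing R] [CommRing S] [Algebra R S] [Group G] (ρ : G →* (S ≃ₐ[R] S))

@[simp]
lemma thetaMap_tmul (u v : S) (γ : G) : thetaMap R S G ρ (u ⊗ₜ v) γ = u * ρ γ v := by
  simp [thetaMap]

variable {ι : Type*} [Fintype ι] {ρ} {u v : ι → S}

/-- The orthogonality relations translated by `σ`. -/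
lemma sum_map_mul_map_eq_ite [DecidableEq G]
    (h : ∀ γ : G, ∑ i, u i * ρ γ (v i) = if γ = 1 then 1 else 0) (σ γ : G) :
    ∑ i, ρ σ (u i) * ρ γ (v i) = if γ = σ then 1 else 0 := by
  have hmap (i : ι) : ρ γ (v i) = ρ σ (ρ (σ⁻¹ * γ) (v i)) := by
    rw [← AlgEquiv.mul_apply, ← map_mul, mul_inv_cancel_left]
  simp only [hmap, ← map_mul (ρ σ), ← map_sum, h]
  simp [apply_ite (ρ σ), inv_mul_eq_one, eq_comm (a := σ)]

variable [Fintype G]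

variable (R ρ u v) in
/-- The candidate inverse of `thetaMap` built from a Galois coordinate system `u, v`. -/
noncomputable def thetaInv (f : G → S) : S ⊗[R] S :=
  ∑ i, (∑ σ, f σ * ρ σ (u i)) ⊗ₜ v i

lemma thetaInv_add (f g : G → S) :
    thetaInv R ρ u v (f + g) = thetaInv R ρ u v f + thetaInv R ρ u v g := by
  simp [thetaInv, add_mul, Finset.sum_add_distrib, TensorProduct.add_tmul]

variable [DecidableEq G]

lemma thetaMap_thetaInv
    (h : ∀ γ : G, ∑ i, u i * ρ γ (v i) = if γ = 1 then 1 else 0) (f : G → S) :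
    thetaMap R S G ρ (thetaInv R ρ u v f) = f := by
  funext γ
  simp only [thetaInv, map_sum, Finset.sum_apply, thetaMap_tmul, Finset.sum_mul]
  rw [Finset.sum_comm]
  simp [mul_assoc, ← Finset.mul_sum, sum_map_mul_map_eq_ite h]

lemma thetaInv_thetaMap
    (hfix : {s : S | ∀ γ : G, ρ γ s = s} ⊆ Set.range (algebraMap R S))
    (h : ∀ γ : G, ∑ i, u i * ρ γ (v i) = if γ = 1 then 1 else 0) (t : S ⊗[R] S) :
    thetaInv R ρ u v (thetaMap R S G ρ t) = t := by
  induction t with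
  | zero => simp [thetaInv]
  | add a b ha hb => rw [map_add, thetaInv_add, ha, hb]
  | tmul x y =>
    have htrace (i : ι) : ∑ σ, ρ σ (y * u i) ∈ Set.range (algebraMap R S) := by
      refine hfix fun γ => ?_
      simp only [map_sum, ← AlgEquiv.mul_apply, ← map_mul ρ]
      exact (Group.mulLeft_bijective γ).sum_comp fun σ => ρ σ (y * u i)
    choose r hr using htrace
    have hy : ∑ i, r i • v i = y := by
      simp only [Algebra.smul_def, hr, Finset.sum_mul]
      rw [Finset.sum_comm]
      have hσ (σ : G) : ∑ i, ρ σ (u i) * v i = if 1 = σ then 1 else 0 := by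
        simpa using sum_map_mul_map_eq_ite h σ 1
      simp [mul_assoc, ← Finset.mul_sum, hσ]
    calc thetaInv R ρ u v (thetaMap R S G ρ (x ⊗ₜ y))
        = ∑ i, (r i • x) ⊗ₜ[R] v i := by
          simp only [thetaInv, thetaMap_tmul, Algebra.smul_def, hr, map_mul, Finset.sum_mul]
          refine Finset.sum_congr rfl fun i _ => congrArg (· ⊗ₜ[R] v i) ?_
          exact Finset.sum_congr rfl fun σ _ => by ring
      _ = x ⊗ₜ y := by
          simp only [TensorProduct.smul_tmul, ← TensorProduct.tmul_sum, hy]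

end Helpers

/-- With `S^G` equal to the image of `R`, `S/R` is `G`-Galois iff there exist
`u₁,…,uₙ, v₁,…,vₙ ∈ S` with `∑ᵢ uᵢ·(γ•vᵢ) = 1` if `γ = 1` and `= 0` otherwise. -/
theorem stmt1 (R S G : Type) [CommRing R] [CommRing S] [Algebra R S]
    [Group G] [Fintype G] [DecidableEq G] (ρ : G →* (S ≃ₐ[R] S))
    (hfix : {s : S | ∀ γ : G, ρ γ s = s} = Set.range (algebraMap R S)) :
    IsBNGaloisExtension R S G ρ ↔
      ∃ (n : ℕ) (u v : Fin n → S), ∀ γ : G,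
        (∑ i, u i * ρ γ (v i)) = if γ = 1 then 1 else 0 := by
  constructor
  · rintro ⟨-, -, hsurj⟩
    obtain ⟨t, ht⟩ := hsurj (Pi.single 1 1)
    obtain ⟨n, u, v, rfl⟩ := TensorProduct.exists_sum_tmul_eq t
    refine ⟨n, u, v, fun γ => ?_⟩
    simpa [Pi.single_apply] using congrFun ht γ
  · rintro ⟨n, u, v, h⟩
    exact ⟨hfix, Function.bijective_iff_has_inverse.mpr
      ⟨thetaInv R ρ u v, thetaInv_thetaMap hfix.subset h, thetaMap_thetaInv h⟩⟩
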